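/- No triangle-local probability distribution P on (Fin 2)³ has support exactly equal to the W pattern {(0,0,1),(0,1,0),(1,0,0)}. -/

import Mathlib

/-- `P` is a local probability distribution in the triangle network: the three
sources are finite independent hidden variables, processed by stochastic
response kernels at the three observers. -/
def IsTriangleLocal (P : Fin 2 → Fin 2 → Fin 2 → ℝ) : Prop :=
  ∃ (nα nβ nγ : ℕ)
    (pα : Fin nα → ℝ) (pβ : Fin nβ → ℝ) (pγ : Fin nγ → ℝ)
    (PA : Fin 2 → Fin nβ → Fin nγ → ℝ)
    (PB : Fin 2 → Fin nγ → Fin nα → ℝ)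
    (PC : Fin 2 → Fin nα → Fin nβ → ℝ),
    (∀ α, 0 ≤ pα α) ∧ (∑ α, pα α) = 1 ∧
    (∀ β, 0 ≤ pβ β) ∧ (∑ β, pβ β) = 1 ∧
    (∀ γ, 0 ≤ pγ γ) ∧ (∑ γ, pγ γ) = 1 ∧
    (∀ a β γ, 0 ≤ PA a β γ) ∧ (∀ β γ, (∑ a, PA a β γ) = 1) ∧
    (∀ b γ α, 0 ≤ PB b γ α) ∧ (∀ γ α, (∑ b, PB b γ α) = 1) ∧
    (∀ c α β, 0 ≤ PC c α β) ∧ (∀ α β, (∑ c, PC c α β) = 1) ∧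
    (∀ a b c, P a b c =
      ∑ α, ∑ β, ∑ γ, pα α * pβ β * pγ γ * PA a β γ * PB b γ α * PC c α β)

/-- A real family summing to one has a positive member. -/
lemma exists_pos_of_sum_eq_one {ι : Type*} [Fintype ι] {f : ι → ℝ} (h : ∑ i, f i = 1) :
    ∃ i, 0 < f i := by
  by_contra! hf
  linarith [Finset.sum_nonpos fun i (_ : i ∈ Finset.univ) => hf i]

/-- A positive triple sum of nonnegative terms has a positive term, and conversely. -/
lemma sum_sum_sum_pos_iff {ι κ μ : Type*} [Fintype ι] [Fintype κ] [Fintype μ]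
    {f : ι → κ → μ → ℝ} (hf : ∀ i j k, 0 ≤ f i j k) :
    0 < ∑ i, ∑ j, ∑ k, f i j k ↔ ∃ i j k, 0 < f i j k := by
  have h2 : ∀ i j, 0 ≤ ∑ k, f i j k := fun i j => Finset.sum_nonneg fun k _ => hf i j k
  have h1 : ∀ i, 0 ≤ ∑ j, ∑ k, f i j k := fun i => Finset.sum_nonneg fun j _ => h2 i j
  rw [Finset.sum_pos_iff_of_nonneg fun i _ => h1 i]
  simp only [Finset.mem_univ, true_and]
  refine exists_congr fun i => ?_
  rw [Finset.sum_pos_iff_of_nonneg fun j _ => h2 i j]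
  simp only [Finset.mem_univ, true_and]
  refine exists_congr fun j => ?_
  rw [Finset.sum_pos_iff_of_nonneg fun k _ => hf i j k]
  simp only [Finset.mem_univ, true_and]

/-- A product of six nonnegative reals is positive iff every factor is. -/
lemma mul_six_pos_iff {u v w x y z : ℝ} (hu : 0 ≤ u) (hv : 0 ≤ v) (hw : 0 ≤ w)
    (hx : 0 ≤ x) (hy : 0 ≤ y) (hz : 0 ≤ z) :
    0 < u * v * w * x * y * z ↔ 0 < u ∧ 0 < v ∧ 0 < w ∧ 0 < x ∧ 0 < y ∧ 0 < z := by
  have hprod : 0 ≤ u * v * w * x * y * z := by positivity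
  simp only [hu.lt_iff_ne', hv.lt_iff_ne', hw.lt_iff_ne', hx.lt_iff_ne', hy.lt_iff_ne',
    hz.lt_iff_ne', hprod.lt_iff_ne', mul_ne_zero_iff, and_assoc]

/-- No triangle-local distribution has support exactly the W pattern
`{(0,0,1),(0,1,0),(1,0,0)}`. -/
theorem no_triangle_local_W :
    ¬ ∃ P : Fin 2 → Fin 2 → Fin 2 → ℝ, IsTriangleLocal P ∧
      ∀ a b c : Fin 2, (0 < P a b c ↔
        ((a, b, c) = ((0 : Fin 2), (0 : Fin 2), (1 : Fin 2)) ∨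
         (a, b, c) = ((0 : Fin 2), (1 : Fin 2), (0 : Fin 2)) ∨
         (a, b, c) = ((1 : Fin 2), (0 : Fin 2), (0 : Fin 2)))) := by
  rintro ⟨P, ⟨nα, nβ, nγ, pα, pβ, pγ, PA, PB, PC, hα, -, hβ, -, hγ, -, hA, hA1, hB, hB1,
    hC, hC1, hP⟩, hW⟩
  have hpos : ∀ a b c, 0 < P a b c ↔ ∃ α β γ, 0 < pα α ∧ 0 < pβ β ∧ 0 < pγ γ ∧
      0 < PA a β γ ∧ 0 < PB b γ α ∧ 0 < PC c α β := by
    intro a b c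
    have hterm := fun α β γ =>
      mul_six_pos_iff (hα α) (hβ β) (hγ γ) (hA a β γ) (hB b γ α) (hC c α β)
    rw [hP, sum_sum_sum_pos_iff fun α β γ => mul_nonneg (mul_nonneg (mul_nonneg (mul_nonneg
      (mul_nonneg (hα α) (hβ β)) (hγ γ)) (hA a β γ)) (hB b γ α)) (hC c α β)]
    simp only [hterm]
  have hsupp {α β γ a b c} (h1 : 0 < pα α) (h2 : 0 < pβ β) (h3 : 0 < pγ γ)
      (ha : 0 < PA a β γ) (hb : 0 < PB b γ α) (hc : 0 < PC c α β) :=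
    (hW a b c).1 ((hpos a b c).2 ⟨α, β, γ, h1, h2, h3, ha, hb, hc⟩)
  obtain ⟨-, β₁, γ₁, -, hβ₁, hγ₁, hA₁, -, -⟩ := (hpos 1 0 0).1 ((hW 1 0 0).2 (by simp))
  obtain ⟨α₂, -, γ₂, hα₂, -, hγ₂, -, hB₂, -⟩ := (hpos 0 1 0).1 ((hW 0 1 0).2 (by simp))
  obtain ⟨α₃, β₃, -, hα₃, hβ₃, -, -, -, hC₃⟩ := (hpos 0 0 1).1 ((hW 0 0 1).2 (by simp))
  -- The sources `α₃, β₁, γ₂` leave no observer able to output `1`.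
  obtain ⟨a, ha⟩ := exists_pos_of_sum_eq_one (hA1 β₁ γ₂)
  obtain ⟨b, hb⟩ := exists_pos_of_sum_eq_one (hB1 γ₂ α₃)
  obtain ⟨c, hc⟩ := exists_pos_of_sum_eq_one (hC1 α₃ β₁)
  rcases hsupp hα₃ hβ₁ hγ₂ ha hb hc with h | h | h <;>
    obtain ⟨rfl, rfl, rfl⟩ := by simpa only [Prod.mk.injEq] using h
  · obtain ⟨b', hb'⟩ := exists_pos_of_sum_eq_one (hB1 γ₁ α₃)
    simpa using hsupp hα₃ hβ₁ hγ₁ hA₁ hb' hc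
  · obtain ⟨a', ha'⟩ := exists_pos_of_sum_eq_one (hA1 β₃ γ₂)
    simpa using hsupp hα₃ hβ₃ hγ₂ ha' hb hC₃
  · obtain ⟨c', hc'⟩ := exists_pos_of_sum_eq_one (hC1 α₂ β₁)
    simpa using hsupp hα₂ hβ₁ hγ₂ ha hB₂ hc'
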